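/- Let X be a compact metric space, f : X → X a continuous map, ψ : X → ℝ continuous, and r ∈ ℝ. Let (n_j) be a sequence of positive integers with n_j → ∞, and for each j let ν_j be a Borel probability measure on X with ν_j({x ∈ X : ∑_{k=0}^{n_j−1} ψ(f^k x) ≥ −r n_j}) = 1. Define μ_j = (1/n_j) ∑_{k=0}^{n_j−1} (f^k)_* ν_j. If μ_j converges weakly-* to a Borel probability measure μ, then μ is f-invariant (i.e. the pushforward f_* μ equals μ) and ∫ ψ dμ ≥ −r. -/

import Mathlib

open Filter Set MeasureTheory

/-- Birkhoff sum `∑_{k=0}^{n-1} ψ(f^k x)`. -/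
noncomputable def birkhoff {X : Type*} (f : X → X) (ψ : X → ℝ) (n : ℕ) (x : X) : ℝ :=
  ∑ k ∈ Finset.range n, ψ (f^[k] x)

theorem Continuous.birkhoff {X : Type*} [TopologicalSpace X] {f : X → X} (hf : Continuous f)
    {ψ : X → ℝ} (hψ : Continuous ψ) (n : ℕ) : Continuous (birkhoff f ψ n) :=
  continuous_finsetSum _ fun k _ => hψ.comp (hf.iterate k)

theorem birkhoff_comp_sub {X : Type*} (f : X → X) (ψ : X → ℝ) (n : ℕ) (x : X) :
    birkhoff f (ψ ∘ f) n x - birkhoff f ψ n x = ψ (f^[n] x) - ψ x := by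
  simp only [birkhoff, Function.comp_apply, ← Function.iterate_succ_apply' f,
    ← Finset.sum_sub_distrib]
  exact Finset.sum_range_sub (fun k => ψ (f^[k] x)) n

section

variable {X : Type*} [TopologicalSpace X] [CompactSpace X] [MeasurableSpace X] [BorelSpace X]

theorem Continuous.integrable_of_isFiniteMeasure {ψ : X → ℝ} (hψ : Continuous ψ)
    (ν : Measure X) [IsFiniteMeasure ν] : Integrable ψ ν :=
  hψ.integrable_of_hasCompactSupport (HasCompactSupport.of_compactSpace ψ)

theorem integral_average_map_iterate {f : X → X} (hf : Continuous f) {ψ : X → ℝ}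
    (hψ : Continuous ψ) (n : ℕ) (ν : Measure X) [IsFiniteMeasure ν] :
    ∫ x, ψ x ∂((n : ENNReal)⁻¹ • ∑ k ∈ Finset.range n, Measure.map (f^[k]) ν) =
      (n : ℝ)⁻¹ * ∫ x, birkhoff f ψ n x ∂ν := by
  rw [integral_smul_measure,
    integral_finsetSum_measure fun k _ => hψ.integrable_of_isFiniteMeasure _]
  simp only [birkhoff]
  rw [integral_finsetSum _ fun k _ =>
    Continuous.integrable_of_isFiniteMeasure (ψ := fun x => ψ (f^[k] x))
      (hψ.comp (hf.iterate k)) ν]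
  simp only [ENNReal.toReal_inv, ENNReal.toReal_natCast, smul_eq_mul]
  congr 1
  refine Finset.sum_congr rfl fun k _ => ?_
  exact integral_map (hf.iterate k).measurable.aemeasurable
    hψ.measurable.aestronglyMeasurable

theorem abs_integral_birkhoff_comp_sub_le {f : X → X} (hf : Continuous f) (h : C(X, ℝ))
    (n : ℕ) (ν : Measure X) [IsProbabilityMeasure ν] :
    |∫ x, birkhoff f (h ∘ f) n x ∂ν - ∫ x, birkhoff f h n x ∂ν| ≤ 2 * ‖h‖ := by
  rw [← integral_sub
    ((hf.birkhoff (h.continuous.comp hf) n).integrable_of_isFiniteMeasure ν)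
    ((hf.birkhoff h.continuous n).integrable_of_isFiniteMeasure ν)]
  simp only [birkhoff_comp_sub]
  have hbound (x : X) : ‖h (f^[n] x) - h x‖ ≤ 2 * ‖h‖ := by
    rw [two_mul]
    exact (norm_sub_le _ _).trans (add_le_add (h.norm_coe_le_norm _) (h.norm_coe_le_norm _))
  simpa using norm_integral_le_of_norm_le_const (ae_of_all ν hbound)

end

/-- If `ν_j` are probability measures giving full mass to the set where the `n_j`-th
Birkhoff sum of `ψ` is `≥ −r n_j`, `n_j → ∞`, and the averaged pushforwards
`μ_j = (1/n_j) ∑_{k<n_j} (f^k)_* ν_j` converge weakly-* to a probability measure `μ`,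
then `μ` is `f`-invariant and `∫ ψ dμ ≥ −r`. -/
theorem limit_of_empirical_measures {X : Type*} [MetricSpace X] [CompactSpace X]
    [MeasurableSpace X] [BorelSpace X]
    (f : X → X) (hf : Continuous f) (ψ : X → ℝ) (hψ : Continuous ψ) (r : ℝ)
    (n : ℕ → ℕ) (hn : ∀ j, 0 < n j) (hn' : Tendsto n atTop atTop)
    (ν : ℕ → Measure X) (hν : ∀ j, IsProbabilityMeasure (ν j))
    (hmass : ∀ j, ν j {x : X | birkhoff f ψ (n j) x ≥ -r * n j} = 1)
    (μ : Measure X) (hμ : IsProbabilityMeasure μ)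
    (hconv : ∀ h : C(X, ℝ),
      Tendsto
        (fun j => ∫ x, h x ∂((n j : ENNReal)⁻¹ •
          ∑ k ∈ Finset.range (n j), Measure.map (f^[k]) (ν j)))
        atTop (nhds (∫ x, h x ∂μ))) :
    Measure.map f μ = μ ∧ ∫ x, ψ x ∂μ ≥ -r := by
  simp only [fun (h : C(X, ℝ)) j =>
    integral_average_map_iterate hf h.continuous (n j) (ν j)] at hconv
  have hn_inv : Tendsto (fun j => (n j : ℝ)⁻¹) atTop (nhds 0) :=
    tendsto_inv_atTop_zero.comp (tendsto_natCast_atTop_atTop.comp hn')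
  constructor
  · have := Measure.isProbabilityMeasure_map (μ := μ) hf.measurable.aemeasurable
    refine ext_of_forall_integral_eq_of_IsFiniteMeasure fun h => ?_
    rw [integral_map hf.measurable.aemeasurable h.continuous.measurable.aestronglyMeasurable]
    have hdiff := (hconv ((h : C(X, ℝ)).comp ⟨f, hf⟩)).sub (hconv (h : C(X, ℝ)))
    refine sub_eq_zero.mp (tendsto_nhds_unique hdiff ?_)
    refine squeeze_zero_norm (a := fun j => (n j : ℝ)⁻¹ * (2 * ‖(h : C(X, ℝ))‖))
      (fun j => ?_) (by simpa using hn_inv.mul_const (2 * ‖(h : C(X, ℝ))‖))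
    rw [← mul_sub, norm_mul, norm_inv, Real.norm_natCast]
    gcongr
    exact abs_integral_birkhoff_comp_sub_le hf (h : C(X, ℝ)) (n j) (ν j)
  · refine ge_of_tendsto' (hconv ⟨ψ, hψ⟩) fun j => ?_
    have hpos : (0 : ℝ) < n j := by exact_mod_cast hn j
    have hcont := hf.birkhoff hψ (n j)
    have hae : ∀ᵐ x ∂ν j, -r * n j ≤ birkhoff f ψ (n j) x :=
      (mem_ae_iff_prob_eq_one (measurableSet_le measurable_const hcont.measurable)).mpr (hmass j)
    have hint : -r * n j ≤ ∫ x, birkhoff f ψ (n j) x ∂ν j := by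
      simpa using integral_mono_ae (integrable_const (-r * n j))
        (hcont.integrable_of_isFiniteMeasure (ν j)) hae
    rw [inv_mul_eq_div, le_div_iff₀ hpos]
    exact hint
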